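/- Let 0<ρ<1, μ∈ℂ, α>0, and let (λ_k) be a nondecreasing sequence of positive reals with λ_k→∞. Then there exist constants C₂>0 and C₃>0 such that for every complex sequence (g_k) with ∑_k λ_k |g_k|² < ∞ and each choice of sign ∓: (i) for every t≥0, ∑_k |α∓√(α²−λ_k)|² |E_{ρ,μ}(−(α∓√(α²−λ_k)) t^ρ)|² |g_k|² ≤ C₂ ∑_k λ_k |g_k|²; and (ii) for every t>0, ∑_k λ_k² |E_{ρ,μ}(−(α∓√(α²−λ_k)) t^ρ)|² |g_k|² ≤ C₃ t^{−2ρ} ∑_k λ_k |g_k|². -/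

import Mathlib

open Filter

/-- The two-parameter Mittag-Leffler function. -/
noncomputable def mlE (ρ : ℝ) (μ : ℂ) (z : ℂ) : ℂ :=
  ∑' k : ℕ, z ^ k / Complex.Gamma (((ρ * k : ℝ) : ℂ) + μ)

/-- The principal complex square root of `α² - λ`. -/
noncomputable def sqrtD (α lam : ℝ) : ℂ := ((α ^ 2 - lam : ℝ) : ℂ) ^ ((1:ℂ)/2)

section GammaIntegrals

open MeasureTheory Set Topology Complex FourierTransform

lemma integrableOn_cpow_mul_cexp_neg_mul {a r : ℂ} (ha : -1 < a.re) (hr : 0 < r.re) :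
    IntegrableOn (fun t : ℝ => (t : ℂ) ^ a * cexp (-(r * t))) (Ioi 0) := by
  have h := integrableOn_rpow_mul_exp_neg_mul_rpow ha one_pos hr
  refine Integrable.mono' h ?_ ?_
  · refine ContinuousOn.aestronglyMeasurable (fun t ht => ?_) measurableSet_Ioi
    have ht' : (t : ℂ) ∈ slitPlane := ofReal_mem_slitPlane.2 ht
    exact ((continuous_ofReal.continuousAt.cpow continuousAt_const ht').mul
      (by fun_prop)).continuousWithinAt
  · refine (ae_restrict_iff' measurableSet_Ioi).2 (Eventually.of_forall fun t ht => ?_)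
    rw [norm_mul, norm_cpow_eq_rpow_re_of_pos ht, norm_exp]
    simp

lemma integral_cpow_mul_cexp_neg_mul_Ioi {a r : ℂ} (ha : 0 < a.re) (hr : 0 < r.re) :
    ∫ t : ℝ in Ioi 0, (t : ℂ) ^ (a - 1) * cexp (-(r * t)) = r ^ (-a) * Gamma a := by
  set U : Set ℂ := {z | 0 < z.re} with hU
  have hUo : IsOpen U := isOpen_lt continuous_const continuous_re
  have hslit : ∀ z ∈ U, z ∈ slitPlane := fun z hz => Or.inl hz
  have hL : DifferentiableOn ℂ
      (fun z : ℂ => ∫ t : ℝ in Ioi 0, (t : ℂ) ^ (a - 1) * cexp (-(z * t))) U := by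
    intro z hz
    have hz' : 0 < z.re / 2 := half_pos hz
    have hs : {w : ℂ | z.re / 2 < w.re} ∈ 𝓝 z :=
      (isOpen_lt continuous_const continuous_re).mem_nhds (half_lt_self (show 0 < z.re from hz))
    have hm : ∀ w ∈ U, AEStronglyMeasurable
        (fun t : ℝ => (t : ℂ) ^ (a - 1) * cexp (-(w * t))) (volume.restrict (Ioi 0)) :=
      fun w hw => (integrableOn_cpow_mul_cexp_neg_mul (by simpa using ha) hw).1
    refine (hasDerivAt_integral_of_dominated_loc_of_deriv_le
      (F := fun w (t : ℝ) => (t : ℂ) ^ (a - 1) * cexp (-(w * t)))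
      (F' := fun w (t : ℝ) => (t : ℂ) ^ (a - 1) * cexp (-(w * t)) * (-t))
      (bound := fun t => t ^ a.re * Real.exp (-(z.re / 2) * t ^ (1 : ℝ)))
      hs (Filter.mem_of_superset (hUo.mem_nhds hz) hm)
      (integrableOn_cpow_mul_cexp_neg_mul (by simpa using ha) hz)
      ((hm z hz).mul (by fun_prop)) ?_ (integrableOn_rpow_mul_exp_neg_mul_rpow (by linarith)
        one_pos hz') ?_).2.differentiableAt.differentiableWithinAt
    · refine (ae_restrict_iff' measurableSet_Ioi).2 (Eventually.of_forall fun t ht w hw => ?_)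
      have ht : 0 < t := ht
      have hw : z.re / 2 < w.re := hw
      rw [norm_mul, norm_mul, norm_cpow_eq_rpow_re_of_pos ht, norm_exp, norm_neg, norm_real,
        Real.norm_of_nonneg ht.le, mul_right_comm]
      have e : t ^ (a - 1).re * t = t ^ a.re := by
        rw [← Real.rpow_add_one ht.ne']; simp
      rw [e]
      gcongr
      simp
      gcongr
    · refine Eventually.of_forall fun t w _ => ?_
      have h : HasDerivAt (fun w : ℂ => -(w * t)) (-(t : ℂ)) w := by
        simpa using ((hasDerivAt_id w).mul_const (t : ℂ)).fun_neg
      simpa [mul_assoc] using (h.cexp).const_mul ((t : ℂ) ^ (a - 1))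
  have hR : DifferentiableOn ℂ (fun z : ℂ => z ^ (-a) * Gamma a) U := fun z hz =>
    ((differentiableAt_id.cpow_const (hslit z hz)).mul_const _).differentiableWithinAt
  have hpre : IsPreconnected U := (convex_halfSpace_re_gt 0).isPreconnected
  have h1 : (1 : ℂ) ∈ U := by simp [hU]
  refine (hL.analyticOnNhd hUo).eqOn_of_preconnected_of_frequently_eq (hR.analyticOnNhd hUo)
    hpre h1 ?_ hr
  have hreal : ∀ x : ℝ, 0 < x →
      ∫ t : ℝ in Ioi 0, (t : ℂ) ^ (a - 1) * cexp (-((x : ℂ) * t)) = (x : ℂ) ^ (-a) * Gamma a := by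
    intro x hx
    rw [integral_cpow_mul_exp_neg_mul_Ioi ha hx, one_div, cpow_neg, inv_cpow]
    rw [arg_ofReal_of_nonneg hx.le]
    exact Real.pi_pos.ne
  have ht : Tendsto (fun x : ℝ => (x : ℂ)) (𝓝[≠] 1) (𝓝[≠] (1 : ℂ)) := by
    refine tendsto_nhdsWithin_of_tendsto_nhds_of_eventually_within _ ?_ ?_
    · exact (continuous_ofReal.tendsto' 1 1 (by simp)).mono_left nhdsWithin_le_nhds
    · filter_upwards [self_mem_nhdsWithin] with x hx
      simpa using hx
  refine ht.frequently (Eventually.frequently ?_)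
  filter_upwards [nhdsWithin_le_nhds (Ioi_mem_nhds one_pos)] with x hx
  exact hreal x hx

/-- The point `c + 2πξi` of the vertical line through `c`. -/
noncomputable def verticalPt (c ξ : ℝ) : ℂ := c + 2 * Real.pi * ξ * I

lemma verticalPt_re (c ξ : ℝ) : (verticalPt c ξ).re = c := by simp [verticalPt]

lemma verticalPt_im (c ξ : ℝ) : (verticalPt c ξ).im = 2 * Real.pi * ξ := by simp [verticalPt]

lemma continuous_verticalPt (c : ℝ) : Continuous (verticalPt c) := by
  unfold verticalPt; fun_prop

lemma verticalPt_ne_zero {c : ℝ} (hc : 0 < c) (ξ : ℝ) : verticalPt c ξ ≠ 0 := fun h => by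
  have := verticalPt_re c ξ
  rw [h] at this
  simp at this
  linarith

lemma le_norm_verticalPt (c ξ : ℝ) : c ≤ ‖verticalPt c ξ‖ := by
  simpa [verticalPt_re] using re_le_norm (verticalPt c ξ)

lemma verticalPt_mem_slitPlane {c : ℝ} (hc : 0 < c) (ξ : ℝ) : verticalPt c ξ ∈ slitPlane :=
  Or.inl (by rwa [verticalPt_re])

lemma continuous_verticalPt_cpow {c : ℝ} (hc : 0 < c) (a : ℂ) :
    Continuous fun ξ => verticalPt c ξ ^ a :=
  continuous_iff_continuousAt.2 fun ξ =>
    (continuous_verticalPt c).continuousAt.cpow continuousAt_const (verticalPt_mem_slitPlane hc ξ)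

lemma integrable_norm_verticalPt_inv_sq {c : ℝ} (hc : 0 < c) :
    Integrable fun ξ => (‖verticalPt c ξ‖ ^ 2)⁻¹ := by
  have h := (integrable_inv_one_add_sq.comp_mul_left' (R := 2 * Real.pi / c)
    (by positivity)).const_mul ((c ^ 2)⁻¹)
  refine h.congr (Eventually.of_forall fun ξ => ?_)
  simp only
  rw [← normSq_eq_norm_sq, normSq_apply, verticalPt_re, verticalPt_im, ← mul_inv]
  congr 1
  field_simp

lemma norm_verticalPt_cpow_le {c : ℝ} (hc : 0 < c) {ν : ℂ} (hν : 2 ≤ ν.re) (ξ : ℝ) :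
    ‖verticalPt c ξ ^ (-ν)‖ ≤
      Real.exp (Real.pi * |ν.im|) * c ^ (2 - ν.re) * (‖verticalPt c ξ‖ ^ 2)⁻¹ := by
  have hs : 0 < ‖verticalPt c ξ‖ := norm_pos_iff.2 (verticalPt_ne_zero hc ξ)
  rw [norm_cpow_of_ne_zero (verticalPt_ne_zero hc ξ), div_eq_mul_inv, ← Real.exp_neg,
    mul_comm, mul_assoc]
  have h1 : ‖verticalPt c ξ‖ ^ (-ν).re = ‖verticalPt c ξ‖ ^ (2 - ν.re) *
      (‖verticalPt c ξ‖ ^ 2)⁻¹ := by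
    rw [← Real.rpow_natCast, ← Real.rpow_neg hs.le, ← Real.rpow_add hs]
    congr 1
    simp
    ring
  rw [h1]
  gcongr ?_ * (?_ * _)
  · apply Real.exp_le_exp.2
    rw [neg_im, mul_neg, neg_neg]
    refine (le_abs_self _).trans ?_
    rw [abs_mul]
    gcongr
    exact abs_arg_le_pi _
  · exact Real.rpow_le_rpow_of_nonpos hc (le_norm_verticalPt c ξ) (by linarith)

lemma integrable_verticalPt_cpow {c : ℝ} (hc : 0 < c) {ν : ℂ} (hν : 2 ≤ ν.re) :
    Integrable fun ξ => verticalPt c ξ ^ (-ν) :=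
  ((integrable_norm_verticalPt_inv_sq hc).const_mul _).mono'
    (continuous_verticalPt_cpow hc _).aestronglyMeasurable
    (Eventually.of_forall (norm_verticalPt_cpow_le hc hν))

lemma norm_cexp_verticalPt (c ξ : ℝ) : ‖cexp (verticalPt c ξ)‖ = Real.exp c := by
  rw [norm_exp, verticalPt_re]

/-- Laplace's formula for the reciprocal of the Gamma function. -/
lemma inv_Gamma_eq_integral {c : ℝ} (hc : 0 < c) {ν : ℂ} (hν : 2 ≤ ν.re) :
    (Gamma ν)⁻¹ = ∫ ξ, cexp (verticalPt c ξ) * verticalPt c ξ ^ (-ν) := by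
  have hν0 : 0 < ν.re := by linarith
  set f : ℝ → ℂ := indicator (Ioi 0) fun t => (t : ℂ) ^ (ν - 1) * cexp (-((c : ℂ) * t)) with hf
  have hfi : Integrable f := (integrable_indicator_iff measurableSet_Ioi).2
    (integrableOn_cpow_mul_cexp_neg_mul (by simp; linarith) (by simpa using hc))
  have hF : 𝓕 f = fun ξ => verticalPt c ξ ^ (-ν) * Gamma ν := by
    ext ξ
    rw [← integral_cpow_mul_cexp_neg_mul_Ioi hν0 (by rwa [verticalPt_re]),
      Real.fourier_real_eq_integral_exp_smul, ← integral_indicator measurableSet_Ioi]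
    congr 1 with t
    simp only [hf, smul_eq_mul, indicator]
    split_ifs
    · rw [mul_left_comm, ← Complex.exp_add]
      congr 2
      simp only [verticalPt]
      push_cast
      ring
    · simp
  have hFi : Integrable (𝓕 f) := by
    rw [hF]; exact (integrable_verticalPt_cpow hc hν).mul_const _
  have hcont : ContinuousAt f 1 := by
    have : f =ᶠ[𝓝 1] fun t : ℝ => (t : ℂ) ^ (ν - 1) * cexp (-((c : ℂ) * t)) := by
      filter_upwards [Ioi_mem_nhds one_pos] with t ht
      simp only [hf, indicator_of_mem ht]
    refine ContinuousAt.congr ?_ this.symm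
    exact (continuous_ofReal.continuousAt.cpow continuousAt_const (by simp)).mul (by fun_prop)
  have hinv := hfi.fourierInv_fourier_eq hFi hcont
  rw [hF, Real.fourierInv_eq'] at hinv
  have hf1 : f 1 = cexp (-c) := by simp [hf]
  have hG : Gamma ν ≠ 0 := Gamma_ne_zero_of_re_pos hν0
  rw [hf1] at hinv
  have key : (∫ ξ, cexp (verticalPt c ξ) * verticalPt c ξ ^ (-ν)) * Gamma ν =
      cexp c * cexp (-c) := by
    rw [← hinv, ← integral_mul_const, ← integral_const_mul]
    congr 1 with ξ
    rw [smul_eq_mul, ← mul_assoc, ← mul_assoc, ← Complex.exp_add]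
    congr 3
    simp [verticalPt]
  rw [← Complex.exp_add, add_neg_cancel, Complex.exp_zero] at key
  exact (eq_inv_of_mul_eq_one_left key).symm

lemma norm_inv_Gamma_le {c : ℝ} (hc : 0 < c) {ν : ℂ} (hν : 2 ≤ ν.re) :
    ‖(Gamma ν)⁻¹‖ ≤ Real.exp c * Real.exp (Real.pi * |ν.im|) * c ^ (2 - ν.re) *
      ∫ ξ, (‖verticalPt c ξ‖ ^ 2)⁻¹ := by
  rw [inv_Gamma_eq_integral hc hν, ← integral_const_mul]
  refine norm_integral_le_of_norm_le ((integrable_norm_verticalPt_inv_sq hc).const_mul _)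
    (Eventually.of_forall fun ξ => ?_)
  rw [norm_mul, norm_cexp_verticalPt, mul_assoc, mul_assoc, ← mul_assoc (Real.exp (_ * _))]
  gcongr
  exact norm_verticalPt_cpow_le hc hν ξ

end GammaIntegrals

section MittagLeffler

open MeasureTheory Set Topology Complex

lemma summable_pow_mul_norm_inv_Gamma {ρ : ℝ} (hρ : 0 < ρ) (μ : ℂ) {R : ℝ} (hR : 0 ≤ R) :
    Summable fun k : ℕ => R ^ k * ‖(Gamma (((ρ * k : ℝ) : ℂ) + μ))⁻¹‖ := by
  set c : ℝ := (R + 1) ^ (1 / ρ) with hcdef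
  have hc : 0 < c := by positivity
  have hcρ : c ^ ρ = R + 1 := by
    rw [hcdef, ← Real.rpow_mul (by positivity), one_div_mul_cancel hρ.ne', Real.rpow_one]
  set M : ℝ := Real.exp c * Real.exp (Real.pi * |μ.im|) * c ^ (2 - μ.re) *
      ∫ ξ, (‖verticalPt c ξ‖ ^ 2)⁻¹ with hM
  have hgeom : Summable fun k : ℕ => M * (R / (R + 1)) ^ k :=
    (summable_geometric_of_lt_one (by positivity)
      ((div_lt_one (by positivity)).2 (by linarith))).mul_left M
  refine Summable.of_norm_bounded_eventually_nat hgeom ?_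
  have hlarge : Tendsto (fun k : ℕ => ρ * k + μ.re) atTop atTop :=
    tendsto_atTop_add_const_right _ _ (tendsto_natCast_atTop_atTop.const_mul_atTop hρ)
  filter_upwards [hlarge.eventually_ge_atTop 2] with k hk
  have hν : (((ρ * k : ℝ) : ℂ) + μ).re = ρ * k + μ.re := by simp
  have hνi : (((ρ * k : ℝ) : ℂ) + μ).im = μ.im := by simp
  have hle := norm_inv_Gamma_le hc (ν := ((ρ * k : ℝ) : ℂ) + μ) (by rw [hν]; exact hk)
  rw [hν, hνi] at hle
  have hpow : c ^ (2 - (ρ * k + μ.re)) = c ^ (2 - μ.re) * ((R + 1) ^ k)⁻¹ := by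
    rw [← hcρ, ← Real.rpow_natCast, ← Real.rpow_mul hc.le, ← Real.rpow_neg hc.le,
      ← Real.rpow_add hc]
    ring_nf
  rw [Real.norm_of_nonneg (by positivity)]
  refine (mul_le_mul_of_nonneg_left hle (by positivity)).trans_eq ?_
  rw [hpow, hM, div_pow]
  ring

lemma norm_mlE_term_le {ρ R : ℝ} {μ z : ℂ} (hz : ‖z‖ ≤ R) (k : ℕ) :
    ‖z ^ k / Gamma (((ρ * k : ℝ) : ℂ) + μ)‖ ≤ R ^ k * ‖(Gamma (((ρ * k : ℝ) : ℂ) + μ))⁻¹‖ := by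
  rw [div_eq_mul_inv, norm_mul, norm_pow]
  gcongr

lemma hasSum_mlE {ρ : ℝ} (hρ : 0 < ρ) (μ z : ℂ) :
    HasSum (fun k : ℕ => z ^ k / Gamma (((ρ * k : ℝ) : ℂ) + μ)) (mlE ρ μ z) :=
  (Summable.of_norm_bounded (summable_pow_mul_norm_inv_Gamma hρ μ (norm_nonneg z))
    fun k => norm_mlE_term_le le_rfl k).hasSum

lemma differentiable_mlE {ρ : ℝ} (hρ : 0 < ρ) (μ : ℂ) : Differentiable ℂ (mlE ρ μ) := fun z =>
  (differentiableOn_tsum_of_summable_norm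
    (summable_pow_mul_norm_inv_Gamma hρ μ (by positivity : 0 ≤ ‖z‖ + 1))
    (fun k => by fun_prop) Metric.isOpen_ball
    (fun k _ hw => norm_mlE_term_le (mem_ball_zero_iff.1 hw).le k)).differentiableAt
    (Metric.isOpen_ball.mem_nhds (by simp : z ∈ Metric.ball 0 (‖z‖ + 1)))

lemma hasSum_deriv_mlE {ρ : ℝ} (hρ : 0 < ρ) (μ z : ℂ) :
    HasSum (fun k : ℕ => (k * z ^ (k - 1)) / Gamma (((ρ * k : ℝ) : ℂ) + μ))
      (deriv (mlE ρ μ) z) := by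
  have h := hasSum_deriv_of_summable_norm (z := z)
    (F := fun (k : ℕ) w => w ^ k / Gamma (((ρ * k : ℝ) : ℂ) + μ))
    (summable_pow_mul_norm_inv_Gamma hρ μ (by positivity : 0 ≤ ‖z‖ + 1))
    (fun k => by fun_prop) Metric.isOpen_ball
    (fun k _ hw => norm_mlE_term_le (mem_ball_zero_iff.1 hw).le k)
    (by simp : z ∈ Metric.ball 0 (‖z‖ + 1))
  refine h.congr_fun fun k => ?_
  simp

lemma mlE_eq_mul_add_deriv {ρ : ℝ} (hρ : 0 < ρ) (μ z : ℂ) :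
    mlE ρ μ z = μ * mlE ρ (μ + 1) z + ρ * z * deriv (mlE ρ (μ + 1)) z := by
  refine (hasSum_mlE hρ μ z).unique ?_
  refine HasSum.congr_fun (((hasSum_mlE hρ (μ + 1) z).mul_left μ).add
    ((hasSum_deriv_mlE hρ (μ + 1) z).mul_left (ρ * z))) fun k => ?_
  rw [div_eq_mul_inv _ (Gamma (((ρ * k : ℝ) : ℂ) + μ)),
    one_div_Gamma_eq_self_mul_one_div_Gamma_add_one, add_assoc]
  rcases k with _ | k
  · simp [div_eq_mul_inv]
  · simp only [div_eq_mul_inv, Nat.add_sub_cancel]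
    push_cast
    ring

/-- The open sector of the points `z` with `-z.re < ε * |z.im|`. -/
def sector (ε : ℝ) : Set ℂ := {z | 0 < z.re + ε * |z.im|}

lemma isOpen_sector (ε : ℝ) : IsOpen (sector ε) :=
  isOpen_lt continuous_const (by fun_prop)

lemma starConvex_sector {ε : ℝ} : StarConvex ℝ 1 (sector ε) := by
  intro z hz a b ha hb hab
  simp only [sector, mem_ofPred_eq] at hz ⊢
  simp only [real_smul, mul_one, add_re, mul_re, ofReal_re, ofReal_im, zero_mul, sub_zero,
    add_im, mul_im, add_zero, zero_add, abs_mul, abs_of_nonneg hb]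
  rcases eq_or_lt_of_le hb with rfl | hb
  · simp at hab ⊢; linarith
  · nlinarith [mul_pos hb hz]

lemma one_mem_sector (ε : ℝ) : (1 : ℂ) ∈ sector ε := by simp [sector]

lemma isPreconnected_sector (ε : ℝ) : IsPreconnected (sector ε) :=
  (starConvex_sector.isPathConnected (one_mem_sector ε)).isConnected.isPreconnected

lemma norm_pos_of_mem_sector {ε : ℝ} {z : ℂ} (hz : z ∈ sector ε) : 0 < ‖z‖ :=
  norm_pos_iff.2 fun h => by simp [sector, h] at hz

lemma mul_norm_le_of_mem_sector {ε δ : ℝ} (hε : 0 ≤ ε) (hεδ : ε < δ) (hδ : δ ≤ 1) {z : ℂ}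
    (hz : z ∈ sector ε) : (δ - ε) / 2 * ‖z‖ ≤ z.re + δ * |z.im| := by
  have h := norm_le_abs_re_add_abs_im z
  have hz : 0 < z.re + ε * |z.im| := hz
  have hi := abs_nonneg z.im
  refine (mul_le_mul_of_nonneg_left h (by linarith)).trans ?_
  rcases abs_cases z.re with ⟨h1, h2⟩ | ⟨h1, h2⟩ <;> rw [h1]
  · nlinarith
  · have hx : -z.re ≤ |z.im| := by nlinarith
    nlinarith [mul_nonneg (sub_nonneg.2 hεδ.le) (sub_nonneg.2 hx)]

lemma mem_sector_of_norm_sub_le {ε δ : ℝ} (hε : 0 ≤ ε) (hεδ : ε < δ) (hδ : δ ≤ 1) {z w : ℂ}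
    (hz : z ∈ sector ε) (hw : ‖w - z‖ ≤ (δ - ε) / 8 * ‖z‖) : w ∈ sector δ := by
  have h := mul_norm_le_of_mem_sector hε hεδ hδ hz
  have hre := (abs_le.1 (abs_re_le_norm (w - z))).1
  have him := (abs_sub_abs_le_abs_sub z.im w.im).trans
    ((abs_sub_comm _ _).le.trans (abs_im_le_norm (w - z)))
  have hpos := mul_pos (sub_pos.2 hεδ) (norm_pos_of_mem_sector hz)
  rw [sub_re] at hre
  have hn := norm_nonneg (w - z)
  simp only [sector, mem_ofPred_eq]
  nlinarith

lemma mul_norm_le_norm_add {ε δ : ℝ} (hε : 0 ≤ ε) (hεδ : ε < δ) (hδ : δ ≤ 1) {z w : ℂ}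
    (hz : z ∈ sector ε) (hw : δ * |w.im| ≤ w.re) : (δ - ε) / 4 * ‖z‖ ≤ ‖w + z‖ := by
  have h := mul_norm_le_of_mem_sector hε hεδ hδ hz
  have hre := re_le_norm (w + z)
  have him := abs_le.1 (abs_im_le_norm (w + z))
  have hwi := abs_le.1 (le_refl |w.im|)
  have hn := norm_nonneg (w + z)
  rw [add_re] at hre
  rw [add_im] at him
  rcases abs_cases z.im with ⟨h1, h2⟩ | ⟨h1, h2⟩ <;> rw [h1] at h <;> nlinarith

lemma cos_mul_abs_im_cpow_le {ρ : ℝ} (hρ0 : 0 < ρ) (hρ1 : ρ < 1) {s : ℂ} (hs : 0 < s.re) :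
    Real.cos (Real.pi / 2 * ρ) * |(s ^ (ρ : ℂ)).im| ≤ (s ^ (ρ : ℂ)).re := by
  have hπ := Real.pi_pos
  have harg : |arg s * ρ| ≤ Real.pi / 2 * ρ := by
    rw [abs_mul, abs_of_pos hρ0]
    gcongr
    exact (abs_arg_lt_pi_div_two_iff.2 (Or.inl hs)).le
  have hlt : Real.pi / 2 * ρ < Real.pi / 2 := by nlinarith
  have hcos : 0 ≤ Real.cos (arg s * ρ) :=
    Real.cos_nonneg_of_neg_pi_div_two_le_of_le (by linarith [(abs_le.1 harg).1])
      (by linarith [(abs_le.1 harg).2])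
  have hsin : |Real.sin (arg s * ρ)| = Real.sin |arg s * ρ| := by
    rw [Real.abs_sin_eq_sin_abs_of_abs_le_pi (by linarith)]
  have h := Real.sin_nonneg_of_nonneg_of_le_pi (sub_nonneg.2 harg)
    (by linarith [abs_nonneg (arg s * ρ)])
  rw [Real.sin_sub, Real.cos_abs] at h
  rw [cpow_ofReal_re, cpow_ofReal_im, abs_mul, abs_of_nonneg (Real.rpow_nonneg (norm_nonneg s) ρ),
    mul_left_comm, hsin]
  gcongr
  nlinarith [Real.sin_le_one (Real.pi / 2 * ρ)]

lemma mul_norm_le_norm_verticalPt_cpow_add {ρ : ℝ} (hρ0 : 0 < ρ) (hρ1 : ρ < 1) {ε : ℝ}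
    (hε0 : 0 ≤ ε) (hε1 : ε < Real.cos (Real.pi / 2 * ρ)) {z : ℂ} (hz : z ∈ sector ε) (ξ : ℝ) :
    (Real.cos (Real.pi / 2 * ρ) - ε) / 4 * ‖z‖ ≤ ‖verticalPt 1 ξ ^ (ρ : ℂ) + z‖ :=
  mul_norm_le_norm_add hε0 hε1 (Real.cos_le_one _) hz
    (cos_mul_abs_im_cpow_le hρ0 hρ1 (by simp [verticalPt_re]))

/-- The integrand of the contour integral for the Mittag-Leffler function at `-z`. -/
noncomputable def mlIntegrand (ρ : ℝ) (μ z : ℂ) (ξ : ℝ) : ℂ :=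
  cexp (verticalPt 1 ξ) * verticalPt 1 ξ ^ (-(μ - ρ)) / (verticalPt 1 ξ ^ (ρ : ℂ) + z)

lemma norm_cexp_mul_verticalPt_cpow_le {ν : ℂ} (hν : 2 ≤ ν.re) (ξ : ℝ) :
    ‖cexp (verticalPt 1 ξ) * verticalPt 1 ξ ^ (-ν)‖ ≤
      Real.exp 1 * Real.exp (Real.pi * |ν.im|) * (‖verticalPt 1 ξ‖ ^ 2)⁻¹ := by
  have h := norm_verticalPt_cpow_le one_pos hν ξ
  rw [Real.one_rpow, mul_one] at h
  rw [norm_mul, norm_cexp_verticalPt, mul_assoc]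
  gcongr

lemma norm_mlIntegrand_le {ρ : ℝ} (hρ0 : 0 < ρ) (hρ1 : ρ < 1) {μ : ℂ} (hμ : 3 ≤ μ.re) {ε : ℝ}
    (hε0 : 0 ≤ ε) (hε1 : ε < Real.cos (Real.pi / 2 * ρ)) {z : ℂ} (hz : z ∈ sector ε) (ξ : ℝ) :
    ‖mlIntegrand ρ μ z ξ‖ ≤ Real.exp 1 * Real.exp (Real.pi * |μ.im|) /
      ((Real.cos (Real.pi / 2 * ρ) - ε) / 4 * ‖z‖) * (‖verticalPt 1 ξ‖ ^ 2)⁻¹ := by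
  have h1 := norm_cexp_mul_verticalPt_cpow_le (ν := μ - ρ) (by simp; linarith) ξ
  have h2 := mul_norm_le_norm_verticalPt_cpow_add hρ0 hρ1 hε0 hε1 hz ξ
  have hpos := norm_pos_of_mem_sector hz
  have hε : 0 < Real.cos (Real.pi / 2 * ρ) - ε := sub_pos.2 hε1
  have him : (μ - ρ).im = μ.im := by simp
  rw [him] at h1
  rw [mlIntegrand, norm_div, div_mul_eq_mul_div]
  gcongr

lemma measurable_mlIntegrand (ρ : ℝ) (μ z : ℂ) : Measurable (mlIntegrand ρ μ z) := by
  have h1 := (continuous_verticalPt_cpow one_pos (-(μ - ρ))).measurable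
  have h2 := (continuous_verticalPt_cpow one_pos (ρ : ℂ)).measurable
  have h3 := (continuous_verticalPt 1).measurable
  unfold mlIntegrand
  exact (h3.cexp.mul h1).div (h2.add_const z)

lemma integrable_mlIntegrand {ρ : ℝ} (hρ0 : 0 < ρ) (hρ1 : ρ < 1) {μ : ℂ} (hμ : 3 ≤ μ.re) {ε : ℝ}
    (hε0 : 0 ≤ ε) (hε1 : ε < Real.cos (Real.pi / 2 * ρ)) {z : ℂ} (hz : z ∈ sector ε) :
    Integrable (mlIntegrand ρ μ z) :=
  ((integrable_norm_verticalPt_inv_sq one_pos).const_mul _).mono'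
    (measurable_mlIntegrand ρ μ z).aestronglyMeasurable
    (Eventually.of_forall (norm_mlIntegrand_le hρ0 hρ1 hμ hε0 hε1 hz))

lemma differentiableOn_integral_mlIntegrand {ρ : ℝ} (hρ0 : 0 < ρ) (hρ1 : ρ < 1) {μ : ℂ}
    (hμ : 3 ≤ μ.re) {ε : ℝ} (hε0 : 0 ≤ ε) (hε1 : ε < Real.cos (Real.pi / 2 * ρ)) :
    DifferentiableOn ℂ (fun z => ∫ ξ, mlIntegrand ρ μ z ξ) (sector ε) := by
  intro z hz
  set κ := (Real.cos (Real.pi / 2 * ρ) - ε) / 4 with hκ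
  have hκ0 : 0 < κ := div_pos (sub_pos.2 hε1) (by norm_num)
  have hz0 := norm_pos_of_mem_sector hz
  set s : Set ℂ := sector ε ∩ {w | ‖z‖ / 2 < ‖w‖} with hs
  have hsn : s ∈ 𝓝 z := ((isOpen_sector ε).inter
    (isOpen_lt continuous_const continuous_norm)).mem_nhds ⟨hz, half_lt_self hz0⟩
  have hlow : ∀ w ∈ s, ∀ ξ, κ * (‖z‖ / 2) ≤ ‖verticalPt 1 ξ ^ (ρ : ℂ) + w‖ := fun w hw ξ =>
    (mul_le_mul_of_nonneg_left (le_of_lt hw.2) hκ0.le).trans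
      (mul_norm_le_norm_verticalPt_cpow_add hρ0 hρ1 hε0 hε1 hw.1 ξ)
  have hne : ∀ w ∈ s, ∀ ξ, verticalPt 1 ξ ^ (ρ : ℂ) + w ≠ 0 := fun w hw ξ =>
    norm_pos_iff.1 (lt_of_lt_of_le (by positivity) (hlow w hw ξ))
  have h2 := (continuous_verticalPt_cpow one_pos (ρ : ℂ)).measurable
  refine (hasDerivAt_integral_of_dominated_loc_of_deriv_le
    (F' := fun w ξ => -(mlIntegrand ρ μ w ξ / (verticalPt 1 ξ ^ (ρ : ℂ) + w)))
    (bound := fun ξ => Real.exp 1 * Real.exp (Real.pi * |μ.im|) / (κ * (‖z‖ / 2)) *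
      (‖verticalPt 1 ξ‖ ^ 2)⁻¹ / (κ * (‖z‖ / 2)))
    hsn (Eventually.of_forall fun w => (measurable_mlIntegrand ρ μ w).aestronglyMeasurable)
    (integrable_mlIntegrand hρ0 hρ1 hμ hε0 hε1 hz) ?_ ?_
    (((integrable_norm_verticalPt_inv_sq one_pos).const_mul _).div_const _)
    ?_).2.differentiableAt.differentiableWithinAt
  · exact ((measurable_mlIntegrand ρ μ z).div (h2.add_const z)).neg.aestronglyMeasurable
  · refine Eventually.of_forall fun ξ w hw => ?_
    rw [norm_neg, norm_div]
    have hb := norm_mlIntegrand_le hρ0 hρ1 hμ hε0 hε1 hw.1 ξ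
    rw [← hκ] at hb
    have hw2 : ‖z‖ / 2 ≤ ‖w‖ := le_of_lt hw.2
    have hl := hlow w hw ξ
    gcongr
    refine hb.trans ?_
    gcongr
  · refine Eventually.of_forall fun ξ w hw => ?_
    have hd : HasDerivAt (fun w => verticalPt 1 ξ ^ (ρ : ℂ) + w) 1 w :=
      (hasDerivAt_id w).const_add _
    have := (hd.fun_inv (hne w hw ξ)).const_mul
      (cexp (verticalPt 1 ξ) * verticalPt 1 ξ ^ (-(μ - ρ)))
    simp only [mlIntegrand, div_eq_mul_inv]
    refine this.congr_deriv ?_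
    field_simp

lemma mlE_neg_eq_integral_of_norm_lt_one {ρ : ℝ} (hρ0 : 0 < ρ) {μ : ℂ} (hμ : 3 ≤ μ.re) {z : ℂ}
    (hz : ‖z‖ < 1) : mlE ρ μ (-z) = ∫ ξ, mlIntegrand ρ μ z ξ := by
  have hre : ∀ k : ℕ, 2 ≤ (((ρ * k : ℝ) : ℂ) + μ).re := fun k => by
    simp only [add_re, ofReal_re]
    have : 0 ≤ ρ * k := by positivity
    linarith
  have him : ∀ k : ℕ, (((ρ * k : ℝ) : ℂ) + μ).im = μ.im := fun k => by simp
  set F : ℕ → ℝ → ℂ := fun k ξ =>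
    (-z) ^ k * (cexp (verticalPt 1 ξ) * verticalPt 1 ξ ^ (-(((ρ * k : ℝ) : ℂ) + μ))) with hF
  set bd : ℝ → ℝ := fun ξ =>
    Real.exp 1 * Real.exp (Real.pi * |μ.im|) * (‖verticalPt 1 ξ‖ ^ 2)⁻¹ with hbd
  have hbdi : Integrable bd := (integrable_norm_verticalPt_inv_sq one_pos).const_mul _
  have hFle : ∀ k ξ, ‖F k ξ‖ ≤ ‖z‖ ^ k * bd ξ := fun k ξ => by
    have h := norm_cexp_mul_verticalPt_cpow_le (hre k) ξ
    rw [him k] at h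
    rw [hF, norm_mul, norm_pow, norm_neg]
    gcongr
  have hFi : ∀ k, Integrable (F k) := fun k =>
    (hbdi.const_mul (‖z‖ ^ k)).mono'
      (((continuous_verticalPt 1).cexp.mul
        (continuous_verticalPt_cpow one_pos _)).const_mul _).aestronglyMeasurable
      (Eventually.of_forall (hFle k))
  have hFs : Summable fun k => ∫ ξ, ‖F k ξ‖ := by
    refine Summable.of_nonneg_of_le (fun k => integral_nonneg fun _ => norm_nonneg _) (fun k => ?_)
      ((summable_geometric_of_lt_one (norm_nonneg z) hz).mul_right (∫ ξ, bd ξ))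
    rw [← integral_const_mul]
    exact integral_mono (hFi k).norm (hbdi.const_mul _) (hFle k)
  have hsum := hasSum_integral_of_summable_integral_norm hFi hFs
  refine (hasSum_mlE hρ0 μ (-z)).unique ?_
  convert! hsum using 1
  · ext k
    rw [hF, integral_const_mul, ← inv_Gamma_eq_integral one_pos (hre k), div_eq_mul_inv]
  · congr 1 with ξ
    set s := verticalPt 1 ξ with hsdef
    have hs0 : s ≠ 0 := verticalPt_ne_zero one_pos ξ
    have hsn : 1 ≤ ‖s ^ (ρ : ℂ)‖ := by
      rw [norm_cpow_real]
      exact Real.one_le_rpow (le_norm_verticalPt 1 ξ) hρ0.le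
    have hsρ : s ^ (ρ : ℂ) ≠ 0 := norm_pos_iff.1 (by linarith)
    have hratio : ‖-z / s ^ (ρ : ℂ)‖ < 1 := by
      rw [norm_div, norm_neg, div_lt_one (by linarith)]
      linarith
    have hadd : s ^ (ρ : ℂ) + z ≠ 0 := fun h => by
      rw [eq_neg_of_add_eq_zero_left h, norm_neg] at hsn
      linarith
    have hg := (hasSum_geometric_of_norm_lt_one hratio).mul_left (cexp s * s ^ (-μ))
    have hterm : ∀ k : ℕ, F k ξ = cexp s * s ^ (-μ) * (-z / s ^ (ρ : ℂ)) ^ k := fun k => by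
      have : s ^ (-(((ρ * k : ℝ) : ℂ) + μ)) = s ^ (-μ) * ((s ^ (ρ : ℂ)) ^ k)⁻¹ := by
        rw [neg_add_rev, cpow_add _ _ hs0, cpow_neg s ((ρ * k : ℝ) : ℂ), ofReal_mul,
          ofReal_natCast, cpow_mul_nat]
      simp only [hF, ← hsdef, this, div_pow]
      ring
    rw [(hg.congr_fun hterm).tsum_eq]
    simp only [mlIntegrand, ← hsdef]
    rw [neg_sub, sub_eq_neg_add, cpow_add _ _ hs0]
    have : 1 - -z / s ^ (ρ : ℂ) = (s ^ (ρ : ℂ) + z) / s ^ (ρ : ℂ) := by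
      field_simp
      ring
    rw [this, inv_div]
    ring

lemma mlE_neg_eq_integral {ρ : ℝ} (hρ0 : 0 < ρ) (hρ1 : ρ < 1) {μ : ℂ} (hμ : 3 ≤ μ.re) {ε : ℝ}
    (hε0 : 0 ≤ ε) (hε1 : ε < Real.cos (Real.pi / 2 * ρ)) {z : ℂ} (hz : z ∈ sector ε) :
    mlE ρ μ (-z) = ∫ ξ, mlIntegrand ρ μ z ξ := by
  have hL : DifferentiableOn ℂ (fun z => mlE ρ μ (-z)) (sector ε) :=
    ((differentiable_mlE hρ0 μ).comp differentiable_neg).differentiableOn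
  have hR := differentiableOn_integral_mlIntegrand hρ0 hρ1 hμ hε0 hε1
  have hmem : (1 / 2 : ℂ) ∈ sector ε := by simp [sector]
  refine (hL.analyticOnNhd (isOpen_sector ε)).eqOn_of_preconnected_of_eventuallyEq
    (hR.analyticOnNhd (isOpen_sector ε)) (isPreconnected_sector ε) hmem ?_ hz
  filter_upwards [Metric.isOpen_ball.mem_nhds
    (by rw [mem_ball_zero_iff]; norm_num : (1 / 2 : ℂ) ∈ Metric.ball 0 1)] with w hw
  exact mlE_neg_eq_integral_of_norm_lt_one hρ0 hμ (mem_ball_zero_iff.1 hw)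

lemma exists_norm_mul_norm_mlE_le_of_three_le {ρ : ℝ} (hρ0 : 0 < ρ) (hρ1 : ρ < 1) {μ : ℂ}
    (hμ : 3 ≤ μ.re) {ε : ℝ} (hε0 : 0 ≤ ε) (hε1 : ε < Real.cos (Real.pi / 2 * ρ)) :
    ∃ C, ∀ z ∈ sector ε, ‖z‖ * ‖mlE ρ μ (-z)‖ ≤ C := by
  have hκ0 : 0 < (Real.cos (Real.pi / 2 * ρ) - ε) / 4 :=
    div_pos (sub_pos.2 hε1) (by norm_num)
  refine ⟨Real.exp 1 * Real.exp (Real.pi * |μ.im|) / ((Real.cos (Real.pi / 2 * ρ) - ε) / 4) *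
    ∫ ξ, (‖verticalPt 1 ξ‖ ^ 2)⁻¹, fun z hz => ?_⟩
  have hz0 := norm_pos_of_mem_sector hz
  have h := norm_integral_le_of_norm_le ((integrable_norm_verticalPt_inv_sq one_pos).const_mul _)
    (Eventually.of_forall (norm_mlIntegrand_le hρ0 hρ1 hμ hε0 hε1 hz))
  rw [← mlE_neg_eq_integral hρ0 hρ1 hμ hε0 hε1 hz, integral_const_mul] at h
  refine (mul_le_mul_of_nonneg_left h hz0.le).trans_eq ?_
  field_simp

/-- The decay `E_{ρ,μ}(-z) = O(1/|z|)` in sectors slightly larger than the right half-plane. -/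
lemma exists_norm_mul_norm_mlE_le {ρ : ℝ} (hρ0 : 0 < ρ) (hρ1 : ρ < 1) (n : ℕ) :
    ∀ μ : ℂ, 3 ≤ μ.re + n → ∀ ε : ℝ, 0 ≤ ε → ε < Real.cos (Real.pi / 2 * ρ) →
      ∃ C, ∀ z ∈ sector ε, ‖z‖ * ‖mlE ρ μ (-z)‖ ≤ C := by
  induction n with
  | zero =>
    intro μ hμ ε hε0 hε1
    exact exists_norm_mul_norm_mlE_le_of_three_le hρ0 hρ1 (by simpa using hμ) hε0 hε1
  | succ n ih =>
    intro μ hμ ε hε0 hε1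
    obtain ⟨δ, hεδ, hδ1⟩ := exists_between hε1
    have hδ : δ ≤ 1 := hδ1.le.trans (Real.cos_le_one _)
    obtain ⟨C, hC⟩ := ih (μ + 1) (by push_cast at hμ; simp; linarith) δ (hε0.trans hεδ.le) hδ1
    set r := (δ - ε) / 8 with hr
    have hr0 : 0 < r := by rw [hr]; linarith
    have hr1 : r ≤ 1 / 2 := by rw [hr]; linarith
    have hsub : ∀ z ∈ sector ε, z ∈ sector δ := fun z hz =>
      mem_sector_of_norm_sub_le hε0 hεδ hδ hz (by simp; positivity)
    refine ⟨‖μ‖ * C + ρ * (2 * C / r), fun z hz => ?_⟩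
    have hz0 := norm_pos_of_mem_sector hz
    have hderiv : ‖deriv (mlE ρ (μ + 1)) (-z)‖ ≤ 2 * C / ‖z‖ / (r * ‖z‖) := by
      refine norm_deriv_le_of_forall_mem_sphere_norm_le (by positivity)
        (differentiable_mlE hρ0 _).diffContOnCl fun w hw => ?_
      rw [mem_sphere_iff_norm, sub_neg_eq_add] at hw
      have hw' : ‖-w - z‖ = r * ‖z‖ := by rw [← hw, ← norm_neg]; congr 1; ring
      have hws := mem_sector_of_norm_sub_le hε0 hεδ hδ hz hw'.le
      have hCw := hC (-w) hws
      rw [neg_neg, norm_neg] at hCw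
      have hwn : ‖z‖ / 2 ≤ ‖w‖ := by
        have := norm_sub_norm_le z (-w)
        rw [norm_neg, norm_sub_rev, hw'] at this
        nlinarith
      rw [le_div_iff₀ hz0]
      nlinarith [norm_nonneg (mlE ρ (μ + 1) w)]
    have hCz := hC z (hsub z hz)
    rw [mlE_eq_mul_add_deriv hρ0]
    calc ‖z‖ * ‖μ * mlE ρ (μ + 1) (-z) + ρ * -z * deriv (mlE ρ (μ + 1)) (-z)‖
        ≤ ‖z‖ * (‖μ‖ * ‖mlE ρ (μ + 1) (-z)‖ +
            ρ * ‖z‖ * (2 * C / ‖z‖ / (r * ‖z‖))) := by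
          gcongr
          refine (norm_add_le _ _).trans ?_
          rw [norm_mul, norm_mul, norm_mul, norm_neg, norm_real, Real.norm_of_nonneg hρ0.le]
          gcongr
      _ = ‖μ‖ * (‖z‖ * ‖mlE ρ (μ + 1) (-z)‖) + ρ * (2 * C / r) := by field_simp
      _ ≤ _ := by gcongr

lemma exists_bound_mlE {ρ : ℝ} (hρ0 : 0 < ρ) (hρ1 : ρ < 1) (μ : ℂ) :
    ∃ M, 0 < M ∧ ∀ z : ℂ, (0 < z.re ∨ z = 0) →
      ‖mlE ρ μ (-z)‖ ≤ M ∧ ‖z‖ * ‖mlE ρ μ (-z)‖ ≤ M := by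
  obtain ⟨n, hn⟩ := exists_nat_ge (3 - μ.re)
  have hcos : 0 < Real.cos (Real.pi / 2 * ρ) := by
    have := Real.pi_pos
    exact Real.cos_pos_of_mem_Ioo ⟨by nlinarith, by nlinarith⟩
  obtain ⟨C, hC⟩ := exists_norm_mul_norm_mlE_le hρ0 hρ1 n μ (by linarith) 0 le_rfl hcos
  obtain ⟨B, hB⟩ := (isCompact_closedBall (0 : ℂ) 1).exists_bound_of_continuousOn
    (differentiable_mlE hρ0 μ).continuous.continuousOn
  have hB0 : 0 ≤ B := (norm_nonneg _).trans (hB 0 (by simp))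
  refine ⟨|C| + B + 1, by positivity, fun z hz => ?_⟩
  have hz2 : ‖z‖ * ‖mlE ρ μ (-z)‖ ≤ |C| := by
    rcases hz with hz | rfl
    · exact (hC z (by simpa [sector] using hz)).trans (le_abs_self C)
    · simp
  refine ⟨?_, by linarith⟩
  rcases le_total ‖z‖ 1 with h | h
  · have := hB (-z) (by simpa using h)
    linarith [abs_nonneg C]
  · nlinarith [norm_nonneg (mlE ρ μ (-z))]

end MittagLeffler

section SpectralRoots

open Complex

lemma sqrtD_sq (α lam : ℝ) : sqrtD α lam ^ 2 = ((α ^ 2 - lam : ℝ) : ℂ) := by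
  have := cpow_nat_inv_pow ((α ^ 2 - lam : ℝ) : ℂ) two_ne_zero
  rw [sqrtD, one_div]
  exact_mod_cast this

lemma sqrtD_re_im (α lam : ℝ) : (sqrtD α lam).re ^ 2 - (sqrtD α lam).im ^ 2 = α ^ 2 - lam ∧
    ((sqrtD α lam).re = 0 ∨ (sqrtD α lam).im = 0) := by
  have h := sqrtD_sq α lam
  have hre := congrArg re h
  have him := congrArg im h
  simp only [sq, mul_re, mul_im, ofReal_re, ofReal_im] at hre him
  refine ⟨by linarith, mul_eq_zero.1 (by linarith)⟩

lemma spectralRoot_re_pos {α lam : ℝ} (hα : 0 < α) (hlam : 0 < lam) {σ : ℂ}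
    (hσ : σ = 1 ∨ σ = -1) : 0 < ((α : ℂ) + σ * sqrtD α lam).re := by
  obtain ⟨h, h0⟩ := sqrtD_re_im α lam
  have habs : |(sqrtD α lam).re| < α := by
    rcases h0 with h0 | h0
    · simpa [h0] using hα
    · refine abs_lt_of_sq_lt_sq ?_ hα.le
      rw [h0] at h
      linarith
  have := abs_lt.1 habs
  rcases hσ with rfl | rfl <;> simp <;> linarith

lemma norm_spectralRoot_sq_le {α lam lam₀ : ℝ} (hα : 0 < α) (h₀ : 0 < lam₀) (hlam : lam₀ ≤ lam)
    {σ : ℂ} (hσ : σ = 1 ∨ σ = -1) :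
    ‖(α : ℂ) + σ * sqrtD α lam‖ ^ 2 ≤ (1 + 4 * α ^ 2 / lam₀) * lam := by
  obtain ⟨h, h0⟩ := sqrtD_re_im α lam
  have hle : 4 * α ^ 2 ≤ 4 * α ^ 2 / lam₀ * lam := by
    rw [div_mul_eq_mul_div, le_div_iff₀ h₀]
    gcongr
  rw [← normSq_eq_norm_sq, normSq_apply]
  have key : (α + (sqrtD α lam).re) ^ 2 + (sqrtD α lam).im ^ 2 ≤ lam + 4 * α ^ 2 ∧
      (α - (sqrtD α lam).re) ^ 2 + (sqrtD α lam).im ^ 2 ≤ lam + 4 * α ^ 2 := by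
    rcases h0 with h0 | h0 <;> rw [h0] at h ⊢ <;> constructor <;>
      nlinarith [sq_nonneg (α - (sqrtD α lam).re), sq_nonneg (α + (sqrtD α lam).re)]
  rcases hσ with rfl | rfl <;> simp <;> nlinarith [key.1, key.2]

lemma norm_spectralRoot_mul_conj {α lam : ℝ} (hlam : 0 < lam) {σ : ℂ} (hσ : σ = 1 ∨ σ = -1) :
    ‖(α : ℂ) + σ * sqrtD α lam‖ * ‖(α : ℂ) + -σ * sqrtD α lam‖ = lam := by
  have hσ2 : σ ^ 2 = 1 := by rcases hσ with rfl | rfl <;> norm_num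
  have : ((α : ℂ) + σ * sqrtD α lam) * ((α : ℂ) + -σ * sqrtD α lam) = (lam : ℂ) := by
    linear_combination (-σ ^ 2) * sqrtD_sq α lam + (-((α ^ 2 - lam : ℝ) : ℂ)) * hσ2 +
      (by push_cast; ring : ((α : ℂ) ^ 2 - ((α ^ 2 - lam : ℝ) : ℂ) = lam))
  rw [← norm_mul, this, norm_real, Real.norm_of_nonneg hlam.le]

end SpectralRoots

lemma tsum_le_mul_tsum_of_le {a b : ℕ → ℝ} {C : ℝ} (ha : ∀ k, 0 ≤ a k) (hb : Summable b)
    (hab : ∀ k, a k ≤ C * b k) : ∑' k, a k ≤ C * ∑' k, b k := by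
  rw [← tsum_mul_left]
  exact (Summable.of_nonneg_of_le ha hab (hb.mul_left C)).tsum_le_tsum hab (hb.mul_left C)

/-- Spectral estimates for data in `D(A^{1/2})`. -/
theorem spectral_estimate_halfdomain
    (ρ : ℝ) (hρ0 : 0 < ρ) (hρ1 : ρ < 1) (μ : ℂ) (α : ℝ) (hα : 0 < α)
    (lam : ℕ → ℝ) (hlam_pos : ∀ k, 0 < lam k) (hlam_mono : Monotone lam)
    (hlam_tend : Tendsto lam atTop atTop) :
    ∃ C₂ > (0:ℝ), ∃ C₃ > (0:ℝ),
      ∀ g : ℕ → ℂ, Summable (fun k => lam k * ‖g k‖ ^ 2) →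
        ∀ σ : ℂ, (σ = 1 ∨ σ = -1) →
          (∀ t : ℝ, 0 ≤ t →
            (∑' k, ‖(α : ℂ) + σ * sqrtD α (lam k)‖ ^ 2 *
                ‖mlE ρ μ (-(((α : ℂ) + σ * sqrtD α (lam k))) * ((t ^ ρ : ℝ) : ℂ))‖ ^ 2 *
                ‖g k‖ ^ 2) ≤
              C₂ * ∑' k, lam k * ‖g k‖ ^ 2) ∧
          (∀ t : ℝ, 0 < t →
            (∑' k, lam k ^ 2 *
                ‖mlE ρ μ (-(((α : ℂ) + σ * sqrtD α (lam k))) * ((t ^ ρ : ℝ) : ℂ))‖ ^ 2 *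
                ‖g k‖ ^ 2) ≤
              C₃ * t ^ (-(2 * ρ)) * ∑' k, lam k * ‖g k‖ ^ 2) := by
  obtain ⟨M, hM, hbound⟩ := exists_bound_mlE hρ0 hρ1 μ
  set K := 1 + 4 * α ^ 2 / lam 0 with hK
  have h0 := hlam_pos 0
  have hK0 : 0 < K := by positivity
  refine ⟨K * M ^ 2, by positivity, K * M ^ 2, by positivity, fun g hg σ hσ => ⟨?_, ?_⟩⟩
  · intro t ht
    refine tsum_le_mul_tsum_of_le (fun k => by positivity) hg fun k => ?_
    set ζ := (α : ℂ) + σ * sqrtD α (lam k) with hζ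
    have hre : 0 < (ζ * ((t ^ ρ : ℝ) : ℂ)).re ∨ ζ * ((t ^ ρ : ℝ) : ℂ) = 0 := by
      rcases ht.eq_or_lt with rfl | ht
      · right; simp [Real.zero_rpow hρ0.ne']
      · left
        rw [Complex.re_mul_ofReal]
        exact mul_pos (spectralRoot_re_pos hα (hlam_pos k) hσ) (Real.rpow_pos_of_pos ht ρ)
    have h1 := (hbound _ hre).1
    rw [← neg_mul] at h1
    have h2 := norm_spectralRoot_sq_le hα h0 (hlam_mono (Nat.zero_le k)) hσ
    have hKk : 0 ≤ K * lam k := (mul_pos hK0 (hlam_pos k)).le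
    calc _ ≤ K * lam k * M ^ 2 * ‖g k‖ ^ 2 := by gcongr
      _ = _ := by ring
  · intro t ht
    refine tsum_le_mul_tsum_of_le (fun k => by positivity) hg fun k => ?_
    set ζ := (α : ℂ) + σ * sqrtD α (lam k) with hζ
    have htρ := Real.rpow_pos_of_pos ht ρ
    have hre : 0 < (ζ * ((t ^ ρ : ℝ) : ℂ)).re := by
      rw [Complex.re_mul_ofReal]
      exact mul_pos (spectralRoot_re_pos hα (hlam_pos k) hσ) htρ
    have h1 := (hbound _ (Or.inl hre)).2
    rw [← neg_mul, norm_mul, Complex.norm_real, Real.norm_of_nonneg htρ.le] at h1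
    have hσ' : -σ = 1 ∨ -σ = -1 := by rcases hσ with rfl | rfl <;> simp
    have h2 := norm_spectralRoot_sq_le hα h0 (hlam_mono (Nat.zero_le k)) hσ'
    have h3 := norm_spectralRoot_mul_conj (α := α) (hlam_pos k) hσ
    rw [← hζ] at h3
    have ht2 : t ^ (-(2 * ρ)) = ((t ^ ρ) ^ 2)⁻¹ := by
      rw [Real.rpow_neg ht.le, mul_comm, Real.rpow_mul ht.le, Real.rpow_two]
    set e := ‖mlE ρ μ (-ζ * ((t ^ ρ : ℝ) : ℂ))‖ with he
    set ζ' := (α : ℂ) + -σ * sqrtD α (lam k)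
    have hKk : 0 ≤ K * lam k := (mul_pos hK0 (hlam_pos k)).le
    calc lam k ^ 2 * e ^ 2 * ‖g k‖ ^ 2
        = ‖ζ'‖ ^ 2 * (‖ζ‖ * t ^ ρ * e) ^ 2 * t ^ (-(2 * ρ)) * ‖g k‖ ^ 2 := by
          rw [ht2, ← h3]
          field_simp
      _ ≤ K * lam k * M ^ 2 * t ^ (-(2 * ρ)) * ‖g k‖ ^ 2 := by gcongr
      _ = _ := by ring
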